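/- arXiv:2501.18858 — 4 statements merged into one kernel-verified Lean document; each statement's English description precedes it below -/
import Mathlib

section
/- Let W be a nonempty finite type and c : W → ℝ with 0 ≤ c w for all w and 0 < c w₀ for some w₀. The marginal log-likelihood function ℓ : (W → ℝ) → ℝ defined by ℓ(f) = Real.log (∑_{w ∈ W} c w * P_f w) is Fréchet differentiable at every f : W → ℝ, with derivative the linear map v ↦ ∑_{w ∈ W} (Q_f w - P_f w) * v w. -/
/-- The softmax (Gibbs) distribution associated with logits `f`. -/
noncomputable def softmax {W : Type*} [Fintype W] (f : W → ℝ) (w : W) : ℝ :=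
  Real.exp (f w) / ∑ w', Real.exp (f w')

/-- The log-partition function of the logits `f`. -/
noncomputable def logPartition {W : Type*} [Fintype W] (f : W → ℝ) : ℝ :=
  Real.log (∑ w, Real.exp (f w))

/-- Kullback–Leibler divergence between finitely supported densities `p` and `q`
(with the convention `0 * log 0 = 0`, which holds definitionally in `ℝ`). -/
noncomputable def KLdiv {W : Type*} [Fintype W] (p q : W → ℝ) : ℝ :=
  ∑ w, p w * Real.log (p w / q w)

/-- Marginal likelihood: the `c`-weighted total mass of the softmax distribution of `f`. -/
noncomputable def margL {W : Type*} [Fintype W] (c f : W → ℝ) : ℝ :=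
  ∑ w, c w * softmax f w

/-- Posterior distribution obtained by reweighting the softmax distribution of `f`
by the evaluation weights `c` and normalizing. -/
noncomputable def post {W : Type*} [Fintype W] (c f : W → ℝ) (w : W) : ℝ :=
  c w * softmax f w / margL c f

/-- The log of a weighted sum of exponentials of the coordinates is differentiable wherever that
sum does not vanish, with derivative the average of the coordinates under the normalized weights. -/
theorem hasFDerivAt_log_sum_mul_exp {W : Type*} [Fintype W] (a f : W → ℝ)
    (h : ∑ w, a w * Real.exp (f w) ≠ 0) :
    HasFDerivAt (fun u : W → ℝ => Real.log (∑ w, a w * Real.exp (u w)))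
      (∑ w : W, (a w * Real.exp (f w) / ∑ w', a w' * Real.exp (f w')) •
        (ContinuousLinearMap.proj w : (W → ℝ) →L[ℝ] ℝ)) f := by
  have hsum : HasFDerivAt (fun u : W → ℝ => ∑ w, a w * Real.exp (u w))
      (∑ w : W, a w • Real.exp (f w) • (ContinuousLinearMap.proj w : (W → ℝ) →L[ℝ] ℝ)) f :=
    HasFDerivAt.fun_sum fun w _ => ((hasFDerivAt_apply w f).exp).const_mul (a w)
  refine (hsum.log h).congr_fderiv ?_
  rw [Finset.smul_sum]
  refine Finset.sum_congr rfl fun w _ => ?_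
  rw [smul_smul, smul_smul, div_eq_inv_mul, mul_assoc]

theorem margL_eq_div {W : Type*} [Fintype W] (c f : W → ℝ) :
    margL c f = (∑ w, c w * Real.exp (f w)) / ∑ w, Real.exp (f w) := by
  simp only [margL, softmax, Finset.sum_div, mul_div_assoc]

theorem post_eq_div {W : Type*} [Fintype W] [Nonempty W] (c f : W → ℝ) (w : W) :
    post c f w = c w * Real.exp (f w) / ∑ w', c w' * Real.exp (f w') := by
  have hZ : ∑ w', Real.exp (f w') ≠ 0 :=
    (Finset.sum_pos (fun w _ => Real.exp_pos (f w)) Finset.univ_nonempty).ne'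
  rw [post, margL_eq_div, softmax, ← mul_div_assoc, div_div_div_cancel_right₀ hZ]

/-- The marginal log-likelihood `f ↦ log (∑ w, c w * P_f w)` is Fréchet differentiable
at every `f`, with derivative the linear map `v ↦ ∑ w, (Q_f w - P_f w) * v w`. -/
theorem hasFDerivAt_log_margL {W : Type*} [Fintype W] [Nonempty W]
    (c : W → ℝ) (hc : ∀ w, 0 ≤ c w) (w₀ : W) (hc₀ : 0 < c w₀) (f : W → ℝ) :
    HasFDerivAt (fun u : W → ℝ => Real.log (∑ w, c w * softmax u w))
      (∑ w : W, (post c f w - softmax f w) •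
        (ContinuousLinearMap.proj w : (W → ℝ) →L[ℝ] ℝ)) f := by
  have hZ : ∀ u : W → ℝ, ∑ w, Real.exp (u w) ≠ 0 := fun u =>
    (Finset.sum_pos (fun w _ => Real.exp_pos (u w)) Finset.univ_nonempty).ne'
  have hS : ∀ u : W → ℝ, ∑ w, c w * Real.exp (u w) ≠ 0 := fun u =>
    (Finset.sum_pos' (fun w _ => mul_nonneg (hc w) (Real.exp_pos (u w)).le)
      ⟨w₀, Finset.mem_univ w₀, mul_pos hc₀ (Real.exp_pos (u w₀))⟩).ne'
  have hlogZ := hasFDerivAt_log_sum_mul_exp (fun _ => 1) f (by simpa using hZ f)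
  simp only [one_mul] at hlogZ
  have hlog : (fun u : W → ℝ => Real.log (∑ w, c w * softmax u w)) = fun u =>
      Real.log (∑ w, c w * Real.exp (u w)) - Real.log (∑ w, Real.exp (u w)) :=
    funext fun u => (congrArg Real.log (margL_eq_div c u)).trans (Real.log_div (hS u) (hZ u))
  rw [hlog]
  refine ((hasFDerivAt_log_sum_mul_exp c f (hS f)).fun_sub hlogZ).congr_fderiv ?_
  simp only [post_eq_div, softmax]
  exact (Finset.sum_sub_distrib _ _).symm.trans
    (Finset.sum_congr rfl fun w _ => (sub_smul _ _ _).symm)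
end

section
/- Let W be a nonempty finite type, c : W → ℝ with 0 ≤ c w for all w and 0 < c w₀ for some w₀. Then for all f, g : W → ℝ, Real.log (L(g)) - Real.log (L(f)) = ∑_{w ∈ W} Q_f w * Real.log (P_g w / P_f w) + KL(Q_f ‖ Q_g), where the sums have terms with Q_f w = 0 contributing 0. -/
theorem softmax_pos {W : Type*} [Fintype W] (f : W → ℝ) (w : W) : 0 < softmax f w :=
  div_pos (Real.exp_pos _) (Finset.sum_pos (fun _ _ => Real.exp_pos _) ⟨w, Finset.mem_univ w⟩)

theorem margL_pos {W : Type*} [Fintype W] {c : W → ℝ} (hc : ∀ w, 0 ≤ c w) {w₀ : W}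
    (hc₀ : 0 < c w₀) (f : W → ℝ) : 0 < margL c f :=
  Finset.sum_pos' (fun w _ => mul_nonneg (hc w) (softmax_pos f w).le)
    ⟨w₀, Finset.mem_univ w₀, mul_pos hc₀ (softmax_pos f w₀)⟩

theorem sum_post {W : Type*} [Fintype W] {c f : W → ℝ} (h : margL c f ≠ 0) :
    ∑ w, post c f w = 1 := by
  simp only [post, ← Finset.sum_div]
  exact div_self h

/-- Exact evidence-lower-bound decomposition: the change in marginal log-likelihood
equals the posterior-weighted log-likelihood-ratio plus the KL divergence between the
posteriors. -/
theorem log_margL_sub_eq {W : Type*} [Fintype W] [Nonempty W]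
    (c : W → ℝ) (hc : ∀ w, 0 ≤ c w) (w₀ : W) (hc₀ : 0 < c w₀) (f g : W → ℝ) :
    Real.log (margL c g) - Real.log (margL c f) =
      (∑ w, post c f w * Real.log (softmax g w / softmax f w)) +
        KLdiv (post c f) (post c g) := by
  have hf := margL_pos hc hc₀ f
  have hg := margL_pos hc hc₀ g
  rw [KLdiv, ← Finset.sum_add_distrib, ← one_mul (Real.log _ - _), ← sum_post hf.ne',
    Finset.sum_mul]
  refine Finset.sum_congr rfl fun w _ => ?_
  rcases (hc w).eq_or_lt with hw | hw
  · simp [post, ← hw]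
  · have hsf := softmax_pos f w
    have hsg := softmax_pos g w
    have key : softmax g w / softmax f w * (post c f w / post c g w) =
        margL c g / margL c f := by
      simp only [post]
      field_simp
    have hpf : 0 < post c f w := div_pos (mul_pos hw hsf) hf
    have hpg : 0 < post c g w := div_pos (mul_pos hw hsg) hg
    rw [← mul_add, ← Real.log_mul (div_pos hsg hsf).ne' (div_pos hpf hpg).ne', key,
      Real.log_div hg.ne' hf.ne']
end

section
/- Let W be a nonempty finite type, c : W → ℝ with 0 ≤ c w for all w and 0 < c w₀ for some w₀. Then for all f, g : W → ℝ, Real.log (L(g)) - Real.log (L(f)) ≥ ∑_{w ∈ W} Q_f w * Real.log (P_g w / P_f w), where terms with Q_f w = 0 contribute 0. -/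
theorem sum_post_mul_softmax_div {W : Type*} [Fintype W] (c f g : W → ℝ) :
    ∑ w, post c f w * (softmax g w / softmax f w) = margL c g / margL c f := by
  rw [margL, Finset.sum_div]
  refine Finset.sum_congr rfl fun w _ => ?_
  have := (softmax_pos f w).ne'
  rw [post]
  field_simp

/-- The improvement in marginal log-likelihood is at least the posterior-weighted
log-likelihood-ratio (by nonnegativity of the KL divergence between posteriors). -/
theorem log_margL_sub_ge {W : Type*} [Fintype W] [Nonempty W]
    (c : W → ℝ) (hc : ∀ w, 0 ≤ c w) (w₀ : W) (hc₀ : 0 < c w₀) (f g : W → ℝ) :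
    Real.log (margL c g) - Real.log (margL c f) ≥
      ∑ w, post c f w * Real.log (softmax g w / softmax f w) := by
  have hf := margL_pos hc hc₀ f
  have hg := margL_pos hc hc₀ g
  rw [← Real.log_div hg.ne' hf.ne', ← sum_post_mul_softmax_div]
  exact strictConcaveOn_log_Ioi.concaveOn.le_map_sum
    (fun w _ => div_nonneg (mul_nonneg (hc w) (softmax_pos f w).le) hf.le)
    (sum_post hf.ne') (fun w _ => div_pos (softmax_pos g w) (softmax_pos f w))
end

section
/- Let S and A be types, next : S → A → S a deterministic transition function, r : S → A → ℝ a reward function, β a positive real number, and V : S → ℝ, Q : S → A → ℝ value functions. Define the policy π : S → A → ℝ by π s a = Real.exp ((Q s a - V s) / β). Let n : ℕ and let s : Fin (n+1) → S and a : Fin (n+1) → A be a trajectory satisfying: s (i+1) = next (s i) (a i) for all i < n; the Bellman consistency Q (s i) (a i) = r (s i) (a i) + V (s (i+1)) for all i < n; and the terminal condition Q (s n) (a n) = r (s n) (a n) (the last action terminates the episode). Then ∏_{i=0}^{n} π (s i) (a i) = Real.exp ((∑_{i=0}^{n} r (s i) (a i) - V (s 0)) / β); in particular, the joint probability of the action sequence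 under π is proportional to Real.exp ((∑_{i=0}^{n} r (s i) (a i)) / β), with proportionality factor Real.exp (-(V (s 0)) / β) depending only on the initial state. -/
/-- Proposition 1 of the paper: in a deterministic entropy-regularized MDP, the softmax
policy `π s a = exp ((Q s a - V s) / β)` generates a trajectory satisfying the Bellman
consistency conditions with probability
`exp ((total reward - V (initial state)) / β)`; in particular this probability is
proportional to the exponential of the total reward divided by `β`, with the
proportionality factor depending only on the initial state. -/
theorem softmax_policy_traj_prob {S A : Type*}
    (next : S → A → S) (r : S → A → ℝ) (β : ℝ) (hβ : 0 < β)
    (V : S → ℝ) (Q : S → A → ℝ)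
    (π : S → A → ℝ) (hπ : ∀ s a, π s a = Real.exp ((Q s a - V s) / β))
    (n : ℕ) (s : Fin (n + 1) → S) (a : Fin (n + 1) → A)
    (htrans : ∀ i : Fin n, s i.succ = next (s i.castSucc) (a i.castSucc))
    (hbellman : ∀ i : Fin n,
      Q (s i.castSucc) (a i.castSucc) = r (s i.castSucc) (a i.castSucc) + V (s i.succ))
    (hterm : Q (s (Fin.last n)) (a (Fin.last n)) = r (s (Fin.last n)) (a (Fin.last n))) :
    ∏ i : Fin (n + 1), π (s i) (a i) =
      Real.exp (((∑ i : Fin (n + 1), r (s i) (a i)) - V (s 0)) / β) := by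
  have hQ : ∑ i, Q (s i) (a i) = ∑ i, r (s i) (a i) + ∑ i : Fin n, V (s i.succ) := by
    rw [Fin.sum_univ_castSucc, Fin.sum_univ_castSucc (fun i => r (s i) (a i)), hterm,
      Finset.sum_congr rfl fun i _ => hbellman i, Finset.sum_add_distrib]
    ring
  have hV : ∑ i, V (s i) = V (s 0) + ∑ i : Fin n, V (s i.succ) := Fin.sum_univ_succ _
  simp_rw [hπ]
  rw [← Real.exp_sum, ← Finset.sum_div, Finset.sum_sub_distrib, hQ, hV, add_sub_add_right_eq_sub]
end
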